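/- Let K be a field, and let H ⊆ G be finite simple connected graphs on the same vertex set (E(H) ⊆ E(G)). Suppose L > 0 is an integer such that for every edge (x,y) of G there is a path in H from x to y of length at most L. Fix for every edge e = (x,y) ∈ E(G)∖E(H) such a path P_e of length at most L, and let ψ: ε_K(G) → ε_K(H) be the K-linear map sending each edge e of H to itself and each edge e = (x,y) ∈ E(G)∖E(H) to the vector of the path P_e. Then for every integer q ≥ 1, ψ induces a well-defined surjective K-linear map ε_K(G)/C^q_K(G) → ε_K(H)/C^{qL}_K(H); in particular |E(G)| − dim_K C^q_K(G) ≥ |E(H)| − dim_K C^{qL}_K(H). -/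

import Mathlib

open Filter Function Set
open scoped Classical TensorProduct Pointwise symmDiff

universe u

namespace GraphSeqPaper

/-- The space of `K`-valued antisymmetric functions supported on the (oriented) edges of `G`:
the `K`-vector space spanned by the edges with the convention `(x,y) = -(y,x)`. -/
def edgeSpace (K : Type*) [Field K] {V : Type u} (G : SimpleGraph V) :
    Submodule K (V → V → K) where
  carrier := {f | (∀ x y, ¬ G.Adj x y → f x y = 0) ∧ ∀ x y, f x y = - f y x}
  add_mem' := by
    rintro f g ⟨hf1, hf2⟩ ⟨hg1, hg2⟩
    refine ⟨fun x y h => ?_, fun x y => ?_⟩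
    · simp only [Pi.add_apply, hf1 x y h, hg1 x y h, add_zero]
    · simp only [Pi.add_apply, hf2 x y, hg2 x y]; ring
  zero_mem' := ⟨fun x y _ => rfl, fun x y => by simp⟩
  smul_mem' := by
    rintro c f ⟨hf1, hf2⟩
    refine ⟨fun x y h => ?_, fun x y => ?_⟩
    · simp only [Pi.smul_apply, hf1 x y h, smul_zero]
    · simp only [Pi.smul_apply, hf2 x y, smul_neg]

lemma edgeSpace_mono (K : Type*) [Field K] {V : Type u} {H G : SimpleGraph V}
    (h : H ≤ G) : edgeSpace K H ≤ edgeSpace K G :=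
  fun f hf => ⟨fun x y hxy => hf.1 x y fun ha => hxy (h ha), hf.2⟩

/-- The basis vector of `ε_K` associated to the oriented edge `(x,y)`. -/
noncomputable def edgeVec (K : Type*) [Field K] {V : Type u} (x y : V) : V → V → K :=
  fun a b => if a = x ∧ b = y then (1 : K) else if a = y ∧ b = x then (-1 : K) else 0

/-- The vector of a walk `(x₀, x₁, …, x_l)`, namely `Σ_{i} (x_i, x_{i+1})`. -/
noncomputable def walkVec (K : Type*) [Field K] {V : Type u} {G : SimpleGraph V} :
    ∀ {x y : V}, G.Walk x y → (V → V → K)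
  | _, _, SimpleGraph.Walk.nil => 0
  | _, _, @SimpleGraph.Walk.cons _ _ a b _ _ p => edgeVec K a b + walkVec K p

/-- `C^q_K(G)`: the subspace of `ε_K(G)` spanned by the vectors of cycles of length at most
`q`. -/
noncomputable def cycleSpace (K : Type*) [Field K] {V : Type u} (G : SimpleGraph V) (q : ℕ) :
    Submodule K (V → V → K) :=
  Submodule.span K
    {f | ∃ (x : V) (c : G.Walk x x), c.IsCycle ∧ c.length ≤ q ∧ f = walkVec K c}

/-- A graph sequence: finite simple graphs, of uniformly bounded vertex degrees, whose number
of vertices tends to infinity. -/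
def IsGraphSeq (V : ℕ → Type u) (G : ∀ n, SimpleGraph (V n)) : Prop :=
  (∀ n, Finite (V n)) ∧
    (∃ D : ℕ, ∀ n (x : V n), ((G n).neighborSet x).ncard ≤ D) ∧
      Tendsto (fun n => Nat.card (V n)) atTop atTop

/-- `ℋ ≺ 𝒢`: there is an integer `L > 0` with `d_{G_n}(x,y) ≤ L · d_{H_n}(x,y)` for all `n`
and all vertices `x, y`. -/
def Prec {V : ℕ → Type u} (H G : ∀ n, SimpleGraph (V n)) : Prop :=
  ∃ L : ℕ, 0 < L ∧ ∀ n (x y : V n), (G n).dist x y ≤ L * (H n).dist x y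

/-- `𝒢 ≃ ℋ`: `ℋ ≺ 𝒢` and `𝒢 ≺ ℋ`. -/
def GEquiv {V : ℕ → Type u} (G H : ∀ n, SimpleGraph (V n)) : Prop :=
  Prec H G ∧ Prec G H

/-- The edge number `e(𝒢) = liminf |E(G_n)|/|V(G_n)|`. -/
noncomputable def edgeNum {V : ℕ → Type u} (G : ∀ n, SimpleGraph (V n)) : ℝ :=
  liminf (fun n => ((G n).edgeSet.ncard : ℝ) / (Nat.card (V n) : ℝ)) atTop

/-- The cost `c(𝒢) = inf { e(ℋ) : ℋ ≃ 𝒢 }`. -/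
noncomputable def cost {V : ℕ → Type u} (G : ∀ n, SimpleGraph (V n)) : ℝ :=
  sInf {r : ℝ | ∃ H : ∀ n, SimpleGraph (V n), IsGraphSeq V H ∧ GEquiv G H ∧ r = edgeNum H}

/-- `s^q_K(𝒢) = liminf (|E(G_n)| - dim_K C^q_K(G_n))/|V(G_n)| - 1`. -/
noncomputable def sInv (K : Type*) [Field K] {V : ℕ → Type u}
    (G : ∀ n, SimpleGraph (V n)) (q : ℕ) : ℝ :=
  liminf (fun n =>
    (((G n).edgeSet.ncard : ℝ) - (Module.finrank K (cycleSpace K (G n) q) : ℝ)) /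
      (Nat.card (V n) : ℝ)) atTop - 1

/-- `β_K(𝒢) = inf_q s^q_K(𝒢)`. -/
noncomputable def beta (K : Type*) [Field K] {V : ℕ → Type u}
    (G : ∀ n, SimpleGraph (V n)) : ℝ :=
  ⨅ q : ℕ, sInv K G q

/-- A large girth sequence: for every `k ≥ 1`, all but finitely many `G_n` contain no cycle of
length at most `k`. -/
def LargeGirth {V : ℕ → Type u} (G : ∀ n, SimpleGraph (V n)) : Prop :=
  ∀ k : ℕ, 1 ≤ k → ∃ N : ℕ, ∀ n, N ≤ n →
    ∀ (x : V n) (c : (G n).Walk x x), c.IsCycle → k < c.length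

/-- The set of edges of `G` whose two endpoints lie in different classes of the partition given
by the fibres of `P`. -/
def crossEdges {V : Type u} (G : SimpleGraph V) (P : V → ℕ) : Set (Sym2 V) :=
  {e | e ∈ G.edgeSet ∧ ∃ x ∈ e, ∃ y ∈ e, P x ≠ P y}

/-- Hyperfiniteness of a graph sequence. -/
def Hyperfinite {V : ℕ → Type u} (G : ∀ n, SimpleGraph (V n)) : Prop :=
  ∀ ε : ℝ, 0 < ε → ∃ Kb : ℕ, ∃ P : ∀ n, V n → ℕ,
    (∀ n i, {x : V n | P n x = i}.ncard ≤ Kb) ∧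
      liminf (fun n => ((crossEdges (G n) (P n)).ncard : ℝ) / (Nat.card (V n) : ℝ)) atTop ≤ ε

/-- The Cayley graph of a group with respect to a (symmetric) set `T`:
`x ~ y` iff `x ≠ y` and `y x⁻¹ ∈ T` (or `x y⁻¹ ∈ T`). -/
def cayley (Q : Type u) [Group Q] (T : Set Q) : SimpleGraph Q :=
  SimpleGraph.fromRel (fun x y => y * x⁻¹ ∈ T)

/-- The Cayley graph of the quotient `Γ ⧸ N` with respect to the image of `S`. -/
def cayleyQuot {Γ : Type u} [Group Γ] (N : Subgroup Γ) (hN : N.Normal) (S : Set Γ) :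
    SimpleGraph (Γ ⧸ N) :=
  haveI := hN
  cayley (Γ ⧸ N) ((fun g => (QuotientGroup.mk g : Γ ⧸ N)) '' S)

/-- The minimal number of generators of a group. -/
noncomputable def minGens (Λ : Type u) [Group Λ] : ℕ :=
  sInf {d : ℕ | ∃ T : Set Λ, T.Finite ∧ T.ncard = d ∧ Subgroup.closure T = ⊤}

/-- A group is finitely presented. -/
def FinitelyPresentedGroup (Γ : Type u) [Group Γ] : Prop :=
  ∃ (n : ℕ) (f : FreeGroup (Fin n) →* Γ) (R : Set (FreeGroup (Fin n))),
    Surjective f ∧ R.Finite ∧ f.ker = Subgroup.normalClosure R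

/-- Amenability via the Følner condition. -/
def IsAmenableFolner (Γ : Type u) [Group Γ] : Prop :=
  ∀ F : Set Γ, F.Finite → ∀ ε : ℝ, 0 < ε →
    ∃ A : Set Γ, A.Finite ∧ A.Nonempty ∧
      ∀ s ∈ F, (((s • A) ∆ A).ncard : ℝ) ≤ ε * A.ncard

/-- The set of edges of `G` joining `F` to its complement. -/
def edgeBoundary {V : Type u} (G : SimpleGraph V) (F : Set V) : Set (Sym2 V) :=
  {e | e ∈ G.edgeSet ∧ ∃ x ∈ e, ∃ y ∈ e, x ∈ F ∧ y ∉ F}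

section EdgeSpace

variable {K : Type*} [Field K] {V : Type u}

lemma edgeVec_swap {x y : V} (h : x ≠ y) : edgeVec K y x = -edgeVec K x y := by
  funext a b
  simp only [edgeVec, Pi.neg_apply]
  split_ifs <;> simp_all

lemma edgeVec_mem_edgeSpace {G : SimpleGraph V} {x y : V} (h : G.Adj x y) :
    edgeVec K x y ∈ edgeSpace K G := by
  refine ⟨fun a b hab => ?_, fun a b => ?_⟩
  · simp only [edgeVec]
    split_ifs with h1 h2
    · obtain ⟨rfl, rfl⟩ := h1; exact absurd h hab
    · obtain ⟨rfl, rfl⟩ := h2; exact absurd h.symm hab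
    · rfl
  · have := h.ne
    simp only [edgeVec]
    split_ifs <;> simp_all

lemma walkVec_mem_edgeSpace {G : SimpleGraph V} {x y : V} (w : G.Walk x y) :
    walkVec K w ∈ edgeSpace K G := by
  induction w with
  | nil => exact Submodule.zero_mem _
  | cons h p ih => exact Submodule.add_mem _ (edgeVec_mem_edgeSpace h) ih

lemma walkVec_append {G : SimpleGraph V} {x y z : V} (p : G.Walk x y) (w : G.Walk y z) :
    walkVec K (p.append w) = walkVec K p + walkVec K w := by
  induction p with
  | nil => simp [walkVec]
  | cons h p ih => simp [walkVec, ih, add_assoc]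

lemma cycleSpace_le_edgeSpace (G : SimpleGraph V) (q : ℕ) :
    cycleSpace K G q ≤ edgeSpace K G := by
  refine Submodule.span_le.2 ?_
  rintro _ ⟨x, c, -, -, rfl⟩
  exact walkVec_mem_edgeSpace c

lemma cycleSpace_mono (G : SimpleGraph V) {m n : ℕ} (h : m ≤ n) :
    cycleSpace K G m ≤ cycleSpace K G n := by
  refine Submodule.span_mono ?_
  rintro _ ⟨x, c, hc, hl, rfl⟩
  exact ⟨x, c, hc, hl.trans h, rfl⟩

/-- Closing up a path by an edge gives a vector of the cycle space: either a cycle, or a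
backtracking edge. -/
lemma walkVec_cons_mem_cycleSpace {G : SimpleGraph V} {x v : V} (h : G.Adj x v)
    (p : G.Walk v x) (hp : p.IsPath) :
    walkVec K (SimpleGraph.Walk.cons h p) ∈ cycleSpace K G (p.length + 1) := by
  by_cases he : s(x, v) ∈ p.edges
  · cases p with
    | nil => exact absurd rfl h.ne
    | @cons _ z _ h' p' =>
      rw [SimpleGraph.Walk.cons_isPath_iff] at hp
      rw [SimpleGraph.Walk.edges_cons, List.mem_cons] at he
      rcases he with he | he
      · have hz : z = x := by
          rcases Sym2.eq_iff.1 he with ⟨h1, -⟩ | ⟨h1, -⟩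
          · exact absurd h1 h.ne
          · exact h1.symm
        subst hz
        obtain rfl := (SimpleGraph.Walk.isPath_iff_nil.1 hp.1).eq_nil
        simp [walkVec, edgeVec_swap h.ne]
      · exact absurd (p'.snd_mem_support_of_mem_edges he) hp.2
  · refine Submodule.subset_span ⟨x, _, ?_, le_rfl, rfl⟩
    exact (SimpleGraph.Walk.cons_isCycle_iff p h).2 ⟨hp, he⟩

/-- A walk agrees with some path up to the span of cycles that are no longer than the walk. -/
lemma exists_path_walkVec_sub_mem_cycleSpace {G : SimpleGraph V} {x y : V} (w : G.Walk x y) :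
    ∃ p : G.Walk x y, p.IsPath ∧ p.length ≤ w.length ∧
      walkVec K w - walkVec K p ∈ cycleSpace K G w.length := by
  induction w with
  | nil => exact ⟨.nil, .nil, le_rfl, by simp⟩
  | @cons x v y h w ih =>
    obtain ⟨p, hp, hl, hm⟩ := ih
    rw [SimpleGraph.Walk.length_cons]
    have hm' := cycleSpace_mono G (Nat.le_succ _) hm
    by_cases hx : x ∈ p.support
    · have hlen := congrArg SimpleGraph.Walk.length (p.take_spec hx)
      rw [SimpleGraph.Walk.length_append] at hlen
      refine ⟨p.dropUntil x hx, hp.dropUntil hx, by omega, ?_⟩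
      have hc := cycleSpace_mono (K := K) G (n := w.length + 1) (by omega)
        (walkVec_cons_mem_cycleSpace h (p.takeUntil x hx) (hp.takeUntil hx))
      have hv := walkVec_append (K := K) (p.takeUntil x hx) (p.dropUntil x hx)
      rw [p.take_spec hx] at hv
      convert Submodule.add_mem _ hm' hc using 1
      simp only [walkVec, hv]
      abel
    · refine ⟨.cons h p, hp.cons hx, by simpa using hl, ?_⟩
      simpa [walkVec] using hm'

lemma walkVec_mem_cycleSpace {G : SimpleGraph V} {x : V} (w : G.Walk x x) :
    walkVec K w ∈ cycleSpace K G w.length := by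
  obtain ⟨p, hp, -, hm⟩ := exists_path_walkVec_sub_mem_cycleSpace (K := K) w
  obtain rfl := (SimpleGraph.Walk.isPath_iff_nil.1 hp).eq_nil
  simpa [walkVec] using hm

lemma exists_walk_map_walkVec {G H : SimpleGraph V} {L : ℕ}
    (ψ : (V → V → K) →ₗ[K] (V → V → K))
    (hψ : ∀ x y : V, G.Adj x y →
      ∃ w : H.Walk x y, w.length ≤ L ∧ ψ (edgeVec K x y) = walkVec K w)
    {x y : V} (w : G.Walk x y) :
    ∃ w' : H.Walk x y, w'.length ≤ w.length * L ∧ ψ (walkVec K w) = walkVec K w' := by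
  induction w with
  | nil => exact ⟨.nil, by simp, by simp [walkVec]⟩
  | @cons a b c h w ih =>
    obtain ⟨w₁, hl₁, h₁⟩ := hψ a b h
    obtain ⟨w₂, hl₂, h₂⟩ := ih
    refine ⟨w₁.append w₂, ?_, ?_⟩
    · rw [SimpleGraph.Walk.length_append, SimpleGraph.Walk.length_cons, Nat.succ_mul]
      omega
    · simp [walkVec, walkVec_append, h₁, h₂]

/-- An edge of `G`, with a chosen orientation, as a vector. -/
noncomputable def orientedEdgeVec (K : Type*) [Field K] (G : SimpleGraph V) (e : G.edgeSet) :
    V → V → K :=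
  edgeVec K (Quot.out e.1).1 (Quot.out e.1).2

lemma mk_out_edge {G : SimpleGraph V} (e : G.edgeSet) :
    s((Quot.out e.1).1, (Quot.out e.1).2) = e.1 :=
  Quot.out_eq e.1

lemma adj_out_edge {G : SimpleGraph V} (e : G.edgeSet) :
    G.Adj (Quot.out e.1).1 (Quot.out e.1).2 := by
  rw [← SimpleGraph.mem_edgeSet, mk_out_edge]
  exact e.2

lemma orientedEdgeVec_mem_edgeSpace {G : SimpleGraph V} (e : G.edgeSet) :
    orientedEdgeVec K G e ∈ edgeSpace K G :=
  edgeVec_mem_edgeSpace (adj_out_edge e)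

lemma orientedEdgeVec_out {G : SimpleGraph V} (e e' : G.edgeSet) :
    orientedEdgeVec K G e (Quot.out e'.1).1 (Quot.out e'.1).2 = if e = e' then 1 else 0 := by
  split_ifs with h
  · subst h; simp [orientedEdgeVec, edgeVec]
  · have hne : e'.1 ≠ e.1 := fun h' => h (Subtype.ext h'.symm)
    rw [← mk_out_edge e, ← mk_out_edge e', Ne, Sym2.eq_iff] at hne
    push Not at hne
    simp only [orientedEdgeVec, edgeVec]
    rw [if_neg (fun h' => hne.1 h'.1 h'.2), if_neg (fun h' => hne.2 h'.1 h'.2)]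

variable [Fintype V]

lemma sum_smul_orientedEdgeVec_out {G : SimpleGraph V} (c : G.edgeSet → K) (e : G.edgeSet) :
    (∑ e', c e' • orientedEdgeVec K G e') (Quot.out e.1).1 (Quot.out e.1).2 = c e := by
  simp [Finset.sum_apply, orientedEdgeVec_out]

lemma eq_sum_orientedEdgeVec {G : SimpleGraph V} {f : V → V → K} (hf : f ∈ edgeSpace K G) :
    f = ∑ e : G.edgeSet, f (Quot.out e.1).1 (Quot.out e.1).2 • orientedEdgeVec K G e := by
  set g := ∑ e : G.edgeSet, f (Quot.out e.1).1 (Quot.out e.1).2 • orientedEdgeVec K G e with hg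
  have hgm : g ∈ edgeSpace K G := Submodule.sum_mem _ fun e _ =>
    Submodule.smul_mem _ _ (orientedEdgeVec_mem_edgeSpace e)
  funext a b
  by_cases hab : G.Adj a b
  · have key := sum_smul_orientedEdgeVec_out
      (fun e : G.edgeSet => f (Quot.out e.1).1 (Quot.out e.1).2) ⟨s(a, b), hab⟩
    rw [← hg] at key
    rcases Sym2.eq_iff.1 (mk_out_edge (⟨s(a, b), hab⟩ : G.edgeSet)) with ⟨h1, h2⟩ | ⟨h1, h2⟩
    · simp only [h1, h2] at key
      exact key.symm
    · simp only [h1, h2] at key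
      rw [hf.2, hgm.2, key]
  · rw [hf.1 a b hab, hgm.1 a b hab]

lemma edgeSpace_eq_span (G : SimpleGraph V) :
    edgeSpace K G = Submodule.span K (range (orientedEdgeVec K G)) := by
  apply le_antisymm
  · intro f hf
    rw [eq_sum_orientedEdgeVec hf]
    exact Submodule.sum_mem _ fun e _ =>
      Submodule.smul_mem _ _ (Submodule.subset_span ⟨e, rfl⟩)
  · rw [Submodule.span_le]
    rintro _ ⟨e, rfl⟩
    exact orientedEdgeVec_mem_edgeSpace e

lemma linearIndependent_orientedEdgeVec (G : SimpleGraph V) :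
    LinearIndependent K (orientedEdgeVec K G) := by
  rw [Fintype.linearIndependent_iff]
  intro c hc e
  rw [← sum_smul_orientedEdgeVec_out c e, hc]
  rfl

lemma finrank_edgeSpace (G : SimpleGraph V) :
    Module.finrank K (edgeSpace K G) = G.edgeSet.ncard := by
  rw [edgeSpace_eq_span, finrank_span_eq_card (linearIndependent_orientedEdgeVec G),
    ← Nat.card_eq_fintype_card, Nat.card_coe_set_eq]

end EdgeSpace

lemma finrank_map_add_finrank_inf_ker {K E F : Type*} [Field K] [AddCommGroup E] [Module K E]
    [AddCommGroup F] [Module K F] [FiniteDimensional K E] (ψ : E →ₗ[K] F) (S : Submodule K E) :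
    Module.finrank K (S.map ψ) + Module.finrank K (S ⊓ LinearMap.ker ψ : Submodule K E) =
      Module.finrank K S := by
  rw [← (ψ.domRestrict S).finrank_range_add_finrank_ker, LinearMap.range_domRestrict,
    LinearMap.ker_domRestrict, ← Submodule.map_comap_subtype,
    Submodule.finrank_map_subtype_eq]

theorem psi_induced_map_surjective (K : Type*) [Field K] {V : Type u} [Fintype V]
    (H G : SimpleGraph V) (hHG : H ≤ G) (hGc : G.Connected) (hHc : H.Connected)
    (L : ℕ) (hL : 0 < L)
    (ψ : (V → V → K) →ₗ[K] (V → V → K))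
    (hψH : ∀ x y : V, H.Adj x y → ψ (edgeVec K x y) = edgeVec K x y)
    (hψG : ∀ x y : V, G.Adj x y → ¬H.Adj x y →
      ∃ w : H.Walk x y, w.length ≤ L ∧ ψ (edgeVec K x y) = walkVec K w)
    (q : ℕ) (hq : 1 ≤ q) :
    (cycleSpace K G q).map ψ ≤ cycleSpace K H (q * L) ∧
      (∀ g ∈ edgeSpace K H, ∃ f ∈ edgeSpace K G, ψ f - g ∈ cycleSpace K H (q * L)) ∧
        ((H.edgeSet.ncard : ℤ) - (Module.finrank K (cycleSpace K H (q * L)) : ℤ) ≤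
          (G.edgeSet.ncard : ℤ) - (Module.finrank K (cycleSpace K G q) : ℤ)) := by
  have hψ : ∀ x y : V, G.Adj x y →
      ∃ w : H.Walk x y, w.length ≤ L ∧ ψ (edgeVec K x y) = walkVec K w := by
    intro x y h
    by_cases hH : H.Adj x y
    · exact ⟨.cons hH .nil, by simpa using Nat.succ_le_of_lt hL, by simp [walkVec, hψH x y hH]⟩
    · exact hψG x y h hH
  have hmap : (cycleSpace K G q).map ψ ≤ cycleSpace K H (q * L) := by
    rw [cycleSpace, Submodule.map_span_le]
    rintro _ ⟨x, c, -, hl, rfl⟩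
    obtain ⟨w, hw, he⟩ := exists_walk_map_walkVec ψ hψ c
    rw [he]
    exact cycleSpace_mono H (hw.trans (Nat.mul_le_mul_right L hl)) (walkVec_mem_cycleSpace w)
  have hfix : ∀ g ∈ edgeSpace K H, ψ g = g := by
    intro g hg
    rw [eq_sum_orientedEdgeVec hg, map_sum]
    refine Finset.sum_congr rfl fun e _ => ?_
    rw [map_smul, orientedEdgeVec, hψH _ _ (adj_out_edge e)]
  refine ⟨hmap, fun g hg => ⟨g, edgeSpace_mono K hHG hg, by simp [hfix g hg]⟩, ?_⟩
  have hle : edgeSpace K H ≤ (edgeSpace K G).map ψ := fun g hg =>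
    ⟨g, edgeSpace_mono K hHG hg, hfix g hg⟩
  have h1 := Submodule.finrank_mono hle
  have h2 := Submodule.finrank_mono hmap
  have h3 := Submodule.finrank_mono
    (inf_le_inf_right (LinearMap.ker ψ) (cycleSpace_le_edgeSpace (K := K) G q))
  have h4 := finrank_map_add_finrank_inf_ker ψ (edgeSpace K G)
  have h5 := finrank_map_add_finrank_inf_ker ψ (cycleSpace K G q)
  rw [finrank_edgeSpace] at h1 h4
  omega

end GraphSeqPaper
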